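/- Let p be an odd prime, let k be an integer, and let α be the p-adic valuation of k (with α = ∞ when k = 0). Then for every integer β ≥ 1: G_k(p^β) = 0 if β ≤ α and β is odd; G_k(p^β) = φ(p^β) (Euler's totient) if β ≤ α and β is even; G_k(p^β) = −p^α if β = α + 1 is even; G_k(p^β) = (k·p^{−α} / p) · p^α · √p if β = α + 1 is odd, where (·/p) is the Legendre symbol; and G_k(p^β) = 0 if β ≥ α + 2. -/

import Mathlib

open scoped Real

/-- `e(x) = e^{2πix}`. -/
noncomputable def eC (x : ℝ) : ℂ := Complex.exp (2 * Real.pi * Complex.I * x)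

/-- `τ_k(n) = Σ_{b mod n} (b/n) e(bk/n)`, where `(·/n)` is the Jacobi symbol. -/
noncomputable def tauG (k : ℤ) (n : ℕ) : ℂ :=
  ∑ b ∈ Finset.range n, (jacobiSym b n : ℂ) * eC (b * k / n)

/-- `G_k(n) = ((1−i)/2 + (−1/n)·(1+i)/2)·τ_k(n)`. -/
noncomputable def GaussG (k : ℤ) (n : ℕ) : ℂ :=
  ((1 - Complex.I) / 2 + (jacobiSym (-1) n : ℂ) * (1 + Complex.I) / 2) * tauG k n

section

open Polynomial Finset

theorem eval_one_iterate_X_mul_derivative {R : Type*} [CommRing R] (m : ℕ) (G : R[X]) :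
    ((fun f : R[X] => X * derivative f)^[m] ((X - 1) ^ m * G)).eval 1 =
      (m.factorial : R) * G.eval 1 := by
  induction m generalizing G with
  | zero => simp
  | succ m ih =>
    have key : X * derivative ((X - 1) ^ (m + 1) * G) =
        (X - 1) ^ m * (((m : R[X]) + 1) * X * G + (X - 1) * X * derivative G) := by
      simp only [derivative_mul, derivative_pow, derivative_sub, derivative_X, derivative_one]
      simp
      ring
    rw [Function.iterate_succ_apply, key, ih]
    simp [Nat.factorial_succ]
    ring

theorem iterate_X_mul_derivative_sum {R : Type*} [CommRing R] (m n : ℕ) (c : ℕ → R) :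
    (fun f : R[X] => X * derivative f)^[m] (∑ j ∈ range n, C (c j) * X ^ j) =
      ∑ j ∈ range n, C (c j * (j : R) ^ m) * X ^ j := by
  induction m with
  | zero => simp
  | succ m ih =>
    rw [Function.iterate_succ_apply', ih, derivative_sum, mul_sum]
    refine sum_congr rfl fun j _ => ?_
    rw [derivative_C_mul_X_pow, pow_succ, ← mul_assoc (c j)]
    rcases j with _ | j
    · simp
    · rw [Nat.add_sub_cancel, pow_succ X j]
      ring

theorem sum_range_natCast_zmod {M : Type*} [AddCommMonoid M] (n : ℕ) [NeZero n] (f : ZMod n → M) :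
    ∑ b ∈ range n, f b = ∑ x, f x :=
  sum_nbij' (fun b => (b : ZMod n)) ZMod.val (by simp) (by simp [ZMod.val_lt])
    (by intro a ha; exact ZMod.val_cast_of_lt (mem_range.mp ha)) (by simp) (by simp)

theorem ringChar_zmod_ne_two (p : ℕ) (hodd : Odd p) : ringChar (ZMod p) ≠ 2 := by
  rw [ZMod.ringChar_zmod_n]
  rintro rfl
  exact absurd hodd (by decide)

theorem sum_quadraticChar_mul_pow_half (p : ℕ) [hp : Fact p.Prime] (hodd : Odd p) :
    ∑ x : ZMod p, ((quadraticChar (ZMod p) x : ℤ) : ZMod p) * x ^ (p / 2) = -1 := by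
  have h2 := ringChar_zmod_ne_two p hodd
  have h : ∀ x : ZMod p, ((quadraticChar (ZMod p) x : ℤ) : ZMod p) * x ^ (p / 2)
      = 1 - if x = 0 then 1 else 0 := by
    intro x
    have h1 := quadraticChar_eq_pow_of_char_ne_two' h2 x
    rw [ZMod.card] at h1
    rw [h1, ← pow_add, show p / 2 + p / 2 = p - 1 by obtain ⟨r, rfl⟩ := hodd; omega]
    split_ifs with hx
    · subst hx
      have := hp.out.two_le
      rw [zero_pow (by omega), sub_self]
    · rw [ZMod.pow_card_sub_one_eq_one hx, sub_zero]
  rw [sum_congr rfl fun x _ => h x]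
  simp

theorem factorial_half_sq (p m : ℕ) [hp : Fact p.Prime] (hm : p = 2 * m + 1) :
    (m.factorial : ZMod p) ^ 2 = (-1) ^ (m + 1) := by
  have hw := ZMod.wilsons_lemma p
  rw [show p - 1 = m + m by omega, ← prod_range_add_one_eq_factorial, prod_range_add,
    ← prod_range_reflect (fun x => m + x + 1)] at hw
  push_cast at hw
  have h1 : ∏ x ∈ range m, ((m : ZMod p) + ((m - 1 - x : ℕ) : ZMod p) + 1)
      = ∏ x ∈ range m, ((-1) * ((x : ZMod p) + 1)) := by
    refine prod_congr rfl fun x hx => ?_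
    have hx := mem_range.mp hx
    have h0 : ((m + (m - 1 - x) + 1 + (x + 1) : ℕ) : ZMod p) = 0 := by
      rw [← ZMod.natCast_self p]
      congr 1
      omega
    push_cast at h0
    linear_combination h0
  rw [h1, prod_mul_distrib, prod_const, card_range] at hw
  rw [← prod_range_add_one_eq_factorial]
  push_cast
  have h4 : ((-1 : ZMod p) ^ m) * (-1) ^ m = 1 := by
    rw [← mul_pow]; simp
  linear_combination ((-1 : ZMod p) ^ m) * hw -
    (∏ x ∈ range m, ((x : ZMod p) + 1)) ^ 2 * h4

/-- The square of the half product attached to a primitive `p`-th root of unity. -/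
theorem half_prod_sq (p m : ℕ) (hm : p = 2 * m + 1) {ζ : ℂ} (hζ : IsPrimitiveRoot ζ p) :
    (∏ k ∈ range m, (ζ ^ (m * (k + 1)) * (ζ ^ (k + 1) - 1))) ^ 2 = (-1) ^ m * (p : ℂ) := by
  have h1 : ζ ^ p = 1 := hζ.pow_eq_one
  have hp := IsPrimitiveRoot.prod_one_sub_pow_eq_order (n := 2 * m) (by rwa [← hm])
  rw [two_mul, prod_range_add, ← prod_range_reflect (fun x => 1 - ζ ^ (m + x + 1)),
    ← prod_mul_distrib] at hp
  have hpc : (p : ℂ) = ((m + m : ℕ) : ℂ) + 1 := by rw [hm]; push_cast; ring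
  rw [hpc, ← hp, ← prod_pow]
  have hc : ((-1 : ℂ)) ^ m = ∏ k ∈ range m, (-1) := by simp
  rw [hc, ← prod_mul_distrib]
  refine prod_congr rfl fun k hk => ?_
  have hk := mem_range.mp hk
  have e1 : ζ ^ (m * (k + 1)) * ζ ^ (m * (k + 1)) * ζ ^ (k + 1) = 1 := by
    rw [← pow_add, ← pow_add, show m * (k + 1) + m * (k + 1) + (k + 1) = p * (k + 1) by
      rw [hm]; ring, pow_mul, h1, one_pow]
  have e2 : ζ ^ (m + (m - 1 - k) + 1) * ζ ^ (k + 1) = 1 := by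
    rw [← pow_add, show m + (m - 1 - k) + 1 + (k + 1) = p by omega, h1]
  have e3 : ζ ^ (m + (m - 1 - k) + 1) = ζ ^ (m * (k + 1)) * ζ ^ (m * (k + 1)) := by
    have h0 : ζ ^ (k + 1) ≠ 0 := right_ne_zero_of_mul_eq_one e2
    exact mul_right_cancel₀ h0 (e2.trans e1.symm)
  rw [e3]
  linear_combination (ζ ^ (k + 1) - 1) * e1

/-- If the quadratic Gauss sum is `ε` times the half product, then `ε ≡ (-1) ^ m` modulo `p`: the
difference of the two polynomials is divisible by `(X - 1) ^ (p - 1)` modulo `p`, so applying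
`X d/dX` to it `m` times and evaluating at `1` gives zero. -/
theorem sign_eq_of_gauss_sum_eq_half_prod (p m : ℕ) [hp : Fact p.Prime] (hm : p = 2 * m + 1) {ζ : ℂ}
    (hζ : IsPrimitiveRoot ζ p) (ε : ℤ)
    (h : ∑ j ∈ range p, (quadraticChar (ZMod p) (j : ZMod p) : ℂ) * ζ ^ j =
      ε * ∏ k ∈ range m, (ζ ^ (m * (k + 1)) * (ζ ^ (k + 1) - 1))) :
    (ε : ZMod p) = (-1) ^ m := by
  have hm0 : 0 < m := by have := hp.out.two_le; omega
  set A : ℤ[X] := ∑ j ∈ range p, C (quadraticChar (ZMod p) (j : ZMod p)) * X ^ j -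
    C ε * ∏ k ∈ range m, (X ^ (m * (k + 1)) * (X ^ (k + 1) - 1)) with hA
  have hA0 : aeval ζ A = 0 := by
    simp only [hA, map_sub, map_sum, map_mul, map_prod, aeval_C, map_pow, aeval_X, map_one]
    rw [sub_eq_zero]
    simpa using h
  have hdvd : cyclotomic p ℤ ∣ A := by
    rw [cyclotomic_eq_minpoly hζ hp.out.pos]
    exact minpoly.isIntegrallyClosed_dvd (hζ.isIntegral hp.out.pos) hA0
  obtain ⟨B, hB⟩ := hdvd
  have hcyc : cyclotomic p (ZMod p) = (X - 1) ^ (p - 1) := by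
    have := cyclotomic_mul_prime_eq_pow_of_not_dvd (ZMod p) (n := 1) (p := p)
      (by simpa using hp.out.ne_one)
    simpa using this
  have hmap := congrArg (Polynomial.map (Int.castRingHom (ZMod p))) hB
  rw [Polynomial.map_mul, map_cyclotomic, hcyc, show p - 1 = m + m by omega, pow_add,
    mul_assoc, hA] at hmap
  simp only [Polynomial.map_sub, Polynomial.map_sum, Polynomial.map_mul, Polynomial.map_prod,
    Polynomial.map_C, Polynomial.map_pow, Polynomial.map_X, Polynomial.map_one] at hmap
  have hprod : ∏ k ∈ range m, ((X : (ZMod p)[X]) ^ (m * (k + 1)) * (X ^ (k + 1) - 1)) =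
      (X - 1) ^ m * ∏ k ∈ range m, (X ^ (m * (k + 1)) * ∑ i ∈ range (k + 1), X ^ i) := by
    have : ((X : (ZMod p)[X]) - 1) ^ m = ∏ k ∈ range m, (X - 1) := by simp
    rw [this, ← prod_mul_distrib]
    refine prod_congr rfl fun k _ => ?_
    rw [← geom_sum_mul]
    ring
  rw [hprod, sub_eq_iff_eq_add, mul_left_comm (C _), ← mul_add] at hmap
  have := congrArg (fun f => ((fun f : (ZMod p)[X] => X * derivative f)^[m] f).eval 1) hmap
  simp only [iterate_X_mul_derivative_sum, eval_one_iterate_X_mul_derivative] at this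
  have hl := sum_quadraticChar_mul_pow_half p ⟨m, hm⟩
  rw [← sum_range_natCast_zmod, show p / 2 = m by omega] at hl
  simp only [eval_finsetSum, eval_mul, eval_C, eval_pow, eval_X, one_pow, mul_one, eval_add,
    eval_sub, eval_one, sub_self, zero_pow hm0.ne', zero_mul, zero_add, eval_prod, one_mul,
    sum_const, card_range, nsmul_eq_mul, eq_intCast] at this
  rw [hl] at this
  have hf := factorial_half_sq p m hm
  have hf' : ∏ k ∈ range m, ((k + 1 : ℕ) : ZMod p) = (m.factorial : ZMod p) := by
    rw [← prod_range_add_one_eq_factorial]; push_cast; rfl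
  rw [hf'] at this
  have h4 : ((-1 : ZMod p) ^ m) * (-1) ^ m = 1 := by
    rw [← mul_pow]; simp
  linear_combination (-1 : ZMod p) ^ m * this + (-1) ^ m * ε * hf - (ε : ZMod p) * h4

theorem gauss_sum_eq_half_prod (p m : ℕ) [hp : Fact p.Prime] (hm : p = 2 * m + 1) {ζ : ℂ}
    (hζ : IsPrimitiveRoot ζ p)
    (hsq : (∑ j ∈ range p, (quadraticChar (ZMod p) (j : ZMod p) : ℂ) * ζ ^ j) ^ 2 =
      (-1) ^ m * (p : ℂ)) :
    ∑ j ∈ range p, (quadraticChar (ZMod p) (j : ZMod p) : ℂ) * ζ ^ j =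
      (-1) ^ m * ∏ k ∈ range m, (ζ ^ (m * (k + 1)) * (ζ ^ (k + 1) - 1)) := by
  have h2 : Fact (2 < p) := ⟨by have := hp.out.two_le; omega⟩
  have hne : (-1 : ZMod p) ≠ 1 := ZMod.neg_one_ne_one
  rw [← half_prod_sq p m hm hζ, sq_eq_sq_iff_eq_or_eq_neg] at hsq
  rcases hsq with h | h
  · have := sign_eq_of_gauss_sum_eq_half_prod p m hm hζ 1 (by simpa using h)
    rcases Nat.even_or_odd m with hm | hm
    · simpa [hm.neg_one_pow] using h
    · simp only [hm.neg_one_pow, Int.cast_one] at this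
      exact absurd this.symm hne
  · have := sign_eq_of_gauss_sum_eq_half_prod p m hm hζ (-1) (by simpa using h)
    rcases Nat.even_or_odd m with hm | hm
    · simp only [hm.neg_one_pow, Int.cast_one, Int.cast_neg] at this
      exact absurd this hne
    · simpa [hm.neg_one_pow] using h

theorem prod_neg_one_pow_mul_I (l : ℕ) :
    ∏ k ∈ range (2 * l), ((-1) ^ k * Complex.I) = 1 := by
  induction l with
  | zero => simp
  | succ l ih =>
    rw [Nat.mul_succ, prod_range_succ, prod_range_succ, ih, pow_succ, (even_two_mul l).neg_one_pow]
    linear_combination -Complex.I_sq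

theorem exp_half_prod_factor (p m k : ℕ) (hm : p = 2 * m + 1) :
    Complex.exp (2 * π * Complex.I / p) ^ (m * (k + 1)) *
      (Complex.exp (2 * π * Complex.I / p) ^ (k + 1) - 1) =
      -((-1) ^ k * Complex.I) * ((2 * Real.sin (π * (k + 1) / p) : ℝ) : ℂ) := by
  have hp : (p : ℂ) ≠ 0 := Nat.cast_ne_zero.mpr (by omega)
  have hpm : (p : ℂ) = 2 * m + 1 := by rw [hm]; push_cast; rfl
  have hs : ((2 * Real.sin (π * (k + 1) / p) : ℝ) : ℂ) =
      (Complex.exp (-(π * (k + 1) / p) * Complex.I) -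
        Complex.exp ((π * (k + 1) / p) * Complex.I)) * Complex.I := by
    push_cast
    rw [Complex.two_sin]
  have h1 : ((-1 : ℂ)) ^ (k + 1) = Complex.exp ((k + 1) * (π * Complex.I)) := by
    rw [← Complex.exp_pi_mul_I, ← Complex.exp_nat_mul]; push_cast; rfl
  rw [hs, show -((-1) ^ k * Complex.I) = (-1) ^ (k + 1) * Complex.I by ring, h1,
    ← Complex.exp_nat_mul, ← Complex.exp_nat_mul]
  have ha : Complex.exp ((k + 1) * (π * Complex.I)) * Complex.I *
      ((Complex.exp (-(π * (k + 1) / p) * Complex.I) -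
        Complex.exp ((π * (k + 1) / p) * Complex.I)) * Complex.I) =
      Complex.exp ((k + 1) * (π * Complex.I)) * Complex.exp ((π * (k + 1) / p) * Complex.I) -
      Complex.exp ((k + 1) * (π * Complex.I)) *
        Complex.exp (-(π * (k + 1) / p) * Complex.I) := by
    linear_combination (Complex.exp ((k + 1) * (π * Complex.I)) *
      (Complex.exp (-(π * (k + 1) / p) * Complex.I) -
        Complex.exp ((π * (k + 1) / p) * Complex.I))) * Complex.I_sq
  rw [ha, mul_sub, mul_one, ← Complex.exp_add, ← Complex.exp_add, ← Complex.exp_add]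
  congr 2
  · push_cast
    field_simp
    rw [hpm]; ring
  · push_cast
    field_simp
    rw [hpm]; ring

/-- Gauss's determination of the sign of the quadratic Gauss sum. -/
theorem normalized_gauss_sum (p m : ℕ) [hp : Fact p.Prime] (hm : p = 2 * m + 1)
    (hsq : (∑ j ∈ range p, (quadraticChar (ZMod p) (j : ZMod p) : ℂ) *
      Complex.exp (2 * π * Complex.I / p) ^ j) ^ 2 = (-1) ^ m * (p : ℂ)) :
    ((1 - Complex.I) / 2 + (-1) ^ m * (1 + Complex.I) / 2) *
      ∑ j ∈ range p, (quadraticChar (ZMod p) (j : ZMod p) : ℂ) *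
        Complex.exp (2 * π * Complex.I / p) ^ j = (Real.sqrt p : ℂ) := by
  have hζ := Complex.isPrimitiveRoot_exp p hp.out.ne_zero
  have hP := half_prod_sq p m hm hζ
  rw [gauss_sum_eq_half_prod p m hm hζ hsq]
  simp only [exp_half_prod_factor p m _ hm] at hP ⊢
  rw [prod_mul_distrib, ← Complex.ofReal_prod] at hP ⊢
  set S : ℝ := ∏ k ∈ range m, (2 * Real.sin (π * (k + 1) / p))
  have hSpos : 0 ≤ S := by
    refine prod_nonneg fun k hk => mul_nonneg zero_le_two (Real.sin_nonneg_of_nonneg_of_le_pi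
      (by positivity) ?_)
    have hk := mem_range.mp hk
    have hp0 : (0 : ℝ) < p := by exact_mod_cast hp.out.pos
    rw [div_le_iff₀ hp0]
    have : ((k : ℝ) + 1) ≤ p := by exact_mod_cast (by omega : k + 1 ≤ p)
    exact mul_le_mul_of_nonneg_left this Real.pi_pos.le
  rw [prod_neg, card_range] at hP ⊢
  have hsqrt (h : (S : ℂ) ^ 2 = p) : (Real.sqrt p : ℂ) = S := by
    have h' : S ^ 2 = p := by exact_mod_cast h
    rw [← h', Real.sqrt_sq hSpos]
  rcases Nat.even_or_odd' m with ⟨l, hl | hl⟩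
  · have he : (-1 : ℂ) ^ m = 1 := (hl ▸ even_two_mul l : Even m).neg_one_pow
    have hu : ∏ k ∈ range m, ((-1) ^ k * Complex.I) = 1 := by rw [hl, prod_neg_one_pow_mul_I]
    rw [he, hu] at hP ⊢
    rw [hsqrt (by linear_combination hP)]
    ring
  · have he : (-1 : ℂ) ^ m = -1 := Odd.neg_one_pow ⟨l, hl⟩
    have hu : ∏ k ∈ range m, ((-1) ^ k * Complex.I) = Complex.I := by
      rw [hl, prod_range_succ, prod_neg_one_pow_mul_I, (even_two_mul l).neg_one_pow]
      ring
    rw [he, hu] at hP ⊢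
    rw [hsqrt (by linear_combination -hP + (S : ℂ) ^ 2 * Complex.I_sq)]
    linear_combination (-(S : ℂ)) * Complex.I_sq

theorem eC_add (x y : ℝ) : eC (x + y) = eC x * eC y := by
  simp only [eC]
  rw [← Complex.exp_add]
  push_cast
  ring_nf

theorem eC_mul_div (n : ℕ) [NeZero n] (b : ℕ) (k : ℤ) :
    eC (b * k / n) = ZMod.stdAddChar ((b : ZMod n) * (k : ZMod n)) := by
  have := ZMod.stdAddChar_coe (N := n) (b * k)
  push_cast at this
  rw [this, eC]
  push_cast
  ring_nf

theorem sum_eC_mul_div (n : ℕ) [NeZero n] (k : ℤ) :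
    ∑ b ∈ range n, eC (b * k / n) = if (n : ℤ) ∣ k then (n : ℂ) else 0 := by
  simp only [eC_mul_div]
  rw [sum_range_natCast_zmod n (fun x => ZMod.stdAddChar (x * (k : ZMod n))),
    AddChar.sum_mulShift _ (ZMod.isPrimitive_stdAddChar n), ZMod.card]
  simp only [ZMod.intCast_zmod_eq_zero_iff_dvd]
  split_ifs <;> simp

theorem sum_range_mul_eq_sum_sum {M : Type*} [AddCommMonoid M] (a b : ℕ) (ha : 0 < a)
    (f : ℕ → M) :
    ∑ x ∈ range (a * b), f x = ∑ r ∈ range a, ∑ s ∈ range b, f (r + a * s) := by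
  rw [← sum_product' (range a) (range b) (fun r s => f (r + a * s))]
  symm
  refine sum_nbij' (fun x => x.1 + a * x.2) (fun x => (x % a, x / a)) ?_ ?_ ?_ ?_ ?_
  · rintro ⟨r, s⟩ h
    simp only [mem_product, mem_range] at h ⊢
    calc r + a * s < a + a * s := by omega
      _ = a * (s + 1) := by ring
      _ ≤ a * b := Nat.mul_le_mul_left _ h.2
  · intro x hx
    simp only [mem_product, mem_range] at hx ⊢
    exact ⟨Nat.mod_lt _ ha, Nat.div_lt_of_lt_mul hx⟩
  · rintro ⟨r, s⟩ h
    simp only [mem_product, mem_range] at h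
    simp [Nat.add_mul_mod_self_left, Nat.mod_eq_of_lt h.1, Nat.add_mul_div_left _ _ ha,
      Nat.div_eq_of_lt h.1]
  · intro x _
    exact Nat.mod_add_div x a
  · intro x _
    rfl

theorem jacobiSym_prime_pow (p : ℕ) [Fact p.Prime] (a : ℤ) (n : ℕ) :
    jacobiSym a (p ^ n) = quadraticChar (ZMod p) (a : ZMod p) ^ n := by
  rw [jacobiSym.pow_right, ← jacobiSym.legendreSym.to_jacobiSym, legendreSym]

theorem tauG_prime_pow_succ (p : ℕ) [hp : Fact p.Prime] (k : ℤ) (n : ℕ) :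
    tauG k (p ^ (n + 1)) =
      (∑ r ∈ range p, (quadraticChar (ZMod p) (r : ZMod p) : ℂ) ^ (n + 1) *
        eC (r * k / (p ^ (n + 1) : ℕ))) * if ((p ^ n : ℕ) : ℤ) ∣ k then ((p ^ n : ℕ) : ℂ) else 0 := by
  have hp0 : (p : ℝ) ≠ 0 := Nat.cast_ne_zero.mpr hp.out.ne_zero
  rw [← sum_eC_mul_div, tauG]
  conv_lhs => rw [pow_succ', sum_range_mul_eq_sum_sum _ _ hp.out.pos, ← pow_succ']
  rw [sum_mul]
  refine sum_congr rfl fun r _ => ?_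
  rw [mul_sum]
  refine sum_congr rfl fun s _ => ?_
  have h1 : (((r + p * s : ℕ) : ℝ) * k / (p ^ (n + 1) : ℕ)) =
      r * k / (p ^ (n + 1) : ℕ) + s * k / (p ^ n : ℕ) := by
    push_cast
    field_simp
    ring
  rw [h1, eC_add, jacobiSym_prime_pow]
  push_cast
  simp
  ring

theorem tauG_eq_zero (p : ℕ) [hp : Fact p.Prime] (k : ℤ) (n : ℕ) (h : ¬ (p : ℤ) ^ n ∣ k) :
    tauG k (p ^ (n + 1)) = 0 := by
  rw [tauG_prime_pow_succ, if_neg (by exact_mod_cast h), mul_zero]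

theorem tauG_prime_pow_mul (p : ℕ) [hp : Fact p.Prime] (c : ℤ) (n : ℕ) :
    tauG (p ^ n * c) (p ^ (n + 1)) = (p : ℂ) ^ n *
      ∑ x : ZMod p, (quadraticChar (ZMod p) x : ℂ) ^ (n + 1) *
        ZMod.stdAddChar (x * (c : ZMod p)) := by
  have hp0 : (p : ℝ) ≠ 0 := Nat.cast_ne_zero.mpr hp.out.ne_zero
  rw [tauG_prime_pow_succ, if_pos (by simp), mul_comm]
  push_cast
  congr 1
  rw [← sum_range_natCast_zmod p (fun x => (quadraticChar (ZMod p) x : ℂ) ^ (n + 1) *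
        ZMod.stdAddChar (x * (c : ZMod p)))]
  refine sum_congr rfl fun r _ => ?_
  rw [← eC_mul_div]
  congr 2
  field_simp
  ring

theorem quadraticChar_pow_of_odd (p : ℕ) [hp : Fact p.Prime] (x : ZMod p) {n : ℕ} (hn : Odd n) :
    (quadraticChar (ZMod p) x : ℂ) ^ n = quadraticChar (ZMod p) x := by
  rcases quadraticChar_isQuadratic (ZMod p) x with h | h | h <;> rw [h]
  · simp [hn.pos.ne']
  · simp
  · simp [hn.neg_one_pow]

theorem quadraticChar_pow_of_even (p : ℕ) [hp : Fact p.Prime] (x : ZMod p) {n : ℕ} (hn : Even n)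
    (h0 : n ≠ 0) : (quadraticChar (ZMod p) x : ℂ) ^ n = 1 - if x = 0 then 1 else 0 := by
  split_ifs with hx
  · rw [hx, quadraticChar_zero]; simp [h0]
  · rcases quadraticChar_dichotomy hx with h | h <;> rw [h] <;> simp [hn.neg_one_pow]

theorem GaussG_of_even (p : ℕ) [hp : Fact p.Prime] (c : ℤ) (n : ℕ)
    (hn : Even (n + 1)) :
    GaussG (p ^ n * c) (p ^ (n + 1)) =
      (p : ℂ) ^ n * ((if (p : ℤ) ∣ c then (p : ℂ) else 0) - 1) := by
  have hJ : (jacobiSym (-1) (p ^ (n + 1)) : ℂ) = 1 := by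
    rw [jacobiSym_prime_pow]
    push_cast
    rw [quadraticChar_pow_of_even p _ hn n.succ_ne_zero]
    simp
  rw [GaussG, tauG_prime_pow_mul, hJ]
  simp only [quadraticChar_pow_of_even p _ hn n.succ_ne_zero, sub_mul, one_mul, sum_sub_distrib]
  rw [AddChar.sum_mulShift _ (ZMod.isPrimitive_stdAddChar p), ZMod.card]
  simp only [ZMod.intCast_zmod_eq_zero_iff_dvd]
  simp
  ring

theorem quadraticChar_neg_one_half (p m : ℕ) [hp : Fact p.Prime] (hm : p = 2 * m + 1) :
    quadraticChar (ZMod p) (-1) = (-1) ^ m := by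
  have h := legendreSym.at_neg_one (p := p) (by omega)
  rw [ZMod.χ₄_eq_neg_one_pow (by omega), show p / 2 = m by omega] at h
  simpa [legendreSym] using h

theorem GaussG_of_odd (p : ℕ) [hp : Fact p.Prime] (hodd : Odd p) (c : ℤ) (n : ℕ)
    (hn : Odd (n + 1)) :
    GaussG (p ^ n * c) (p ^ (n + 1)) = (legendreSym p c : ℂ) * (p : ℂ) ^ n * (Real.sqrt p : ℂ) := by
  obtain ⟨m, hm⟩ := id hodd
  have h2 := ringChar_zmod_ne_two p hodd
  have hneg := quadraticChar_neg_one_half p m hm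
  have hJ : (jacobiSym (-1) (p ^ (n + 1)) : ℂ) = (-1) ^ m := by
    rw [jacobiSym_prime_pow]
    push_cast
    rw [quadraticChar_pow_of_odd p _ hn, hneg]
    push_cast
    rfl
  rw [GaussG, tauG_prime_pow_mul, hJ]
  simp only [quadraticChar_pow_of_odd p _ hn]
  set χ : MulChar (ZMod p) ℂ := (quadraticChar (ZMod p)).ringHomComp (Int.castRingHom ℂ)
  have hχa (x : ZMod p) : χ x = (quadraticChar (ZMod p) x : ℂ) := rfl
  have hχ1 : χ ≠ 1 :=
    (MulChar.ringHomComp_ne_one_iff (RingHom.injective_int _)).mpr (quadraticChar_ne_one h2)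
  have hχ2 : χ.IsQuadratic := (quadraticChar_isQuadratic (ZMod p)).comp _
  have hsum : gaussSum χ ZMod.stdAddChar = ∑ j ∈ range p,
      (quadraticChar (ZMod p) (j : ZMod p) : ℂ) * Complex.exp (2 * π * Complex.I / p) ^ j := by
    rw [gaussSum, ← sum_range_natCast_zmod]
    refine sum_congr rfl fun j _ => ?_
    have := ZMod.stdAddChar_coe (N := p) j
    rw [Int.cast_natCast] at this
    rw [hχa, this, ← Complex.exp_nat_mul]
    push_cast
    ring_nf
  have hsq := gaussSum_sq hχ1 hχ2 (ZMod.isPrimitive_stdAddChar p)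
  rw [hχa, hneg, ZMod.card, hsum] at hsq
  have hmain := normalized_gauss_sum p m hm (by simpa using hsq)
  rw [← hsum] at hmain
  rw [legendreSym]
  by_cases hc : (c : ZMod p) = 0
  · have hz := quadraticChar_sum_zero h2
    have hz' : ∑ x : ZMod p, (quadraticChar (ZMod p) x : ℂ) = 0 := by exact_mod_cast hz
    rw [hc, quadraticChar_zero]
    simp only [mul_zero, AddChar.map_zero_eq_one, mul_one, hz', Int.cast_zero, zero_mul]
  · have hshift := gaussSum_mulShift χ ZMod.stdAddChar (Units.mk0 (c : ZMod p) hc)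
    have hcc : (quadraticChar (ZMod p) (c : ZMod p) : ℂ) ^ 2 = 1 := by
      exact_mod_cast quadraticChar_sq_one hc
    rw [gaussSum] at hshift
    simp only [AddChar.mulShift_apply, Units.val_mk0, hχa, mul_comm (c : ZMod p)] at hshift
    rw [← hmain, ← hshift]
    linear_combination (-((1 - Complex.I) / 2 + (-1) ^ m * (1 + Complex.I) / 2) * (p : ℂ) ^ n *
      ∑ x : ZMod p, (quadraticChar (ZMod p) x : ℂ) * ZMod.stdAddChar (x * (c : ZMod p))) * hcc

theorem GaussG_eq_zero_of_dvd (p : ℕ) [hp : Fact p.Prime] (hodd : Odd p) (k : ℤ) (β : ℕ)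
    (h : (p : ℤ) ^ β ∣ k) (hβ : Odd β) : GaussG k (p ^ β) = 0 := by
  obtain ⟨n, rfl⟩ : ∃ n, β = n + 1 := ⟨β - 1, by have := hβ.pos; omega⟩
  obtain ⟨c, rfl⟩ := h
  rw [pow_succ (p : ℤ), mul_assoc, GaussG_of_odd p hodd _ n hβ,
    (legendreSym.eq_zero_iff p _).mpr (by simp)]
  simp

theorem GaussG_eq_totient_of_dvd (p : ℕ) [hp : Fact p.Prime] (k : ℤ) (β : ℕ)
    (h : (p : ℤ) ^ β ∣ k) (hβ : Even β) (h0 : 1 ≤ β) :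
    GaussG k (p ^ β) = (Nat.totient (p ^ β) : ℂ) := by
  obtain ⟨n, rfl⟩ : ∃ n, β = n + 1 := ⟨β - 1, by omega⟩
  obtain ⟨c, rfl⟩ := h
  rw [pow_succ (p : ℤ), mul_assoc, GaussG_of_even p _ n hβ, if_pos (dvd_mul_right _ _),
    Nat.totient_prime_pow_succ hp.out]
  push_cast [hp.out.one_le]
  rfl

end

/-- Let `p` be an odd prime, `k` an integer, and `α` the `p`-adic valuation of
`k` (with `α = ∞` when `k = 0`, so that when `k = 0` only the conditions `β ≤ α` hold).
Then for every `β ≥ 1`: `G_k(p^β) = 0` if `β ≤ α` is odd; `G_k(p^β) = φ(p^β)` if `β ≤ α` is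
even; `G_k(p^β) = −p^α` if `β = α + 1` is even; `G_k(p^β) = (k p^{−α}/p)·p^α·√p` if
`β = α + 1` is odd; and `G_k(p^β) = 0` if `β ≥ α + 2`. -/
theorem stmt_7 (p : ℕ) [hp : Fact p.Prime] (hodd : Odd p) (k : ℤ) (β : ℕ) (hβ : 1 ≤ β) :
    (k = 0 →
      (Odd β → GaussG k (p ^ β) = 0) ∧
      (Even β → GaussG k (p ^ β) = (Nat.totient (p ^ β) : ℂ))) ∧
    (k ≠ 0 →
      (β ≤ padicValInt p k ∧ Odd β → GaussG k (p ^ β) = 0) ∧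
      (β ≤ padicValInt p k ∧ Even β → GaussG k (p ^ β) = (Nat.totient (p ^ β) : ℂ)) ∧
      (β = padicValInt p k + 1 ∧ Even β → GaussG k (p ^ β) = -((p : ℂ) ^ padicValInt p k)) ∧
      (β = padicValInt p k + 1 ∧ Odd β →
        GaussG k (p ^ β) = (legendreSym p (k / (p : ℤ) ^ padicValInt p k) : ℂ) *
          (p : ℂ) ^ padicValInt p k * (Real.sqrt p : ℂ)) ∧
      (padicValInt p k + 2 ≤ β → GaussG k (p ^ β) = 0)) := by
  constructor
  · rintro rfl
    exact ⟨GaussG_eq_zero_of_dvd p hodd 0 β (dvd_zero _),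
      fun h => GaussG_eq_totient_of_dvd p 0 β (dvd_zero _) h hβ⟩
  · intro hk
    have hdvd (n : ℕ) : (p : ℤ) ^ n ∣ k ↔ n ≤ padicValInt p k := by
      rw [padicValInt_dvd_iff]
      simp [hk]
    have hpow : (p : ℤ) ^ padicValInt p k ≠ 0 :=
      pow_ne_zero _ (Int.natCast_ne_zero.mpr hp.out.ne_zero)
    refine ⟨fun h => GaussG_eq_zero_of_dvd p hodd k β ((hdvd β).mpr h.1) h.2,
      fun h => GaussG_eq_totient_of_dvd p k β ((hdvd β).mpr h.1) h.2 hβ, ?_, ?_, ?_⟩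
    · rintro ⟨rfl, hE⟩
      obtain ⟨c, hc⟩ := padicValInt_dvd (p := p) k
      have hpc : ¬ (p : ℤ) ∣ c := by
        intro h
        have h' := mul_dvd_mul_left ((p : ℤ) ^ padicValInt p k) h
        rw [← hc, ← pow_succ, hdvd] at h'
        omega
      have h := GaussG_of_even p c _ hE
      rw [← hc, if_neg hpc] at h
      rw [h]
      ring
    · rintro ⟨rfl, hO⟩
      have hc := Int.mul_ediv_cancel' (padicValInt_dvd (p := p) k)
      have h := GaussG_of_odd p hodd (k / (p : ℤ) ^ padicValInt p k) _ hO
      rwa [hc] at h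
    · intro h
      obtain ⟨n, rfl⟩ : ∃ n, β = n + 1 := ⟨β - 1, by omega⟩
      rw [GaussG, tauG_eq_zero p k n (by rw [hdvd]; omega), mul_zero]
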